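/- arXiv:2104.11613 — 2 statements merged into one kernel-verified Lean document; each statement's English description precedes it below -/
import Mathlib

section
/- The Erdős–Milner theorem (special case for ordinals): Let α, β, γ be ordinals with α additively indecomposable, β countable (β < ω₁), k > 1 a natural number, and suppose α → (k, γ)². Then α·β → (2k, min(γ, ω·β))². -/
open Ordinal Set

noncomputable def otype (A : Set Ordinal) : Ordinal.{1} :=
  Ordinal.type ((· < ·) : A → A → Prop)

def MonoColor (f : Finset Ordinal → Fin 2) (S : Set Ordinal) (c : Fin 2) : Prop :=
  ∀ x ∈ S, ∀ y ∈ S, x ≠ y → f {x, y} = c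

def PartRel (α β γ : Ordinal.{0}) : Prop :=
  ∀ f : Finset Ordinal → Fin 2,
    (∃ B ⊆ Set.Iio α, otype B = Ordinal.lift.{1} β ∧ MonoColor f B 0) ∨
    (∃ C ⊆ Set.Iio α, otype C = Ordinal.lift.{1} γ ∧ MonoColor f C 1)

def Indecomp (α : Ordinal) : Prop := ∀ β < α, ∀ γ < α, β + γ < α

/-- `X` contains a subset of order type `κ`. -/
def ContainsType (κ : Ordinal.{0}) (X : Set Ordinal.{0}) : Prop :=
  ∃ φ : Ordinal → Ordinal, StrictMonoOn φ (Iio κ) ∧ MapsTo φ (Iio κ) X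

theorem otype_image {κ : Ordinal.{0}} {φ : Ordinal → Ordinal} (hφ : StrictMonoOn φ (Iio κ)) :
    otype (φ '' Iio κ) = lift.{1} κ := by
  rw [← type_lt_Iio κ]
  exact ((hφ.orderIso φ (Iio κ)).symm.toRelIsoLT).ordinalType_congr

theorem containsType_iff_le_otype {κ : Ordinal.{0}} {X : Set Ordinal.{0}} :
    ContainsType κ X ↔ lift.{1} κ ≤ otype X := by
  constructor
  · rintro ⟨φ, hφ, hX⟩
    rw [← otype_image hφ]
    exact type_mono hX.image_subset
  · intro h
    rw [← type_lt_Iio κ, otype, type_le_iff'] at h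
    obtain ⟨g⟩ := h
    refine ⟨fun o ↦ if ho : o < κ then g ⟨o, ho⟩ else 0, fun a ha b hb hab ↦ ?_, fun a ha ↦ ?_⟩
    · simp only [mem_Iio] at ha hb
      simpa [ha, hb] using g.map_rel_iff.2 (show (⟨a, ha⟩ : Iio κ) < ⟨b, hb⟩ from hab)
    · simp only [mem_Iio] at ha
      simp [ha]

namespace ContainsType

theorem mono_set {κ : Ordinal} {X Y : Set Ordinal} (h : ContainsType κ X) (hXY : X ⊆ Y) :
    ContainsType κ Y :=
  h.imp fun _ hφ ↦ ⟨hφ.1, hφ.2.mono_right hXY⟩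

theorem mono_type {κ μ : Ordinal} {X : Set Ordinal} (h : ContainsType κ X) (hμ : μ ≤ κ) :
    ContainsType μ X :=
  h.imp fun _ hφ ↦ ⟨hφ.1.mono (Iio_subset_Iio hμ), hφ.2.mono_left (Iio_subset_Iio hμ)⟩

theorem of_subsingleton {X : Set Ordinal} (hX : X.Subsingleton) {κ : Ordinal}
    (h : ContainsType κ X) : κ ≤ 1 := by
  obtain ⟨φ, hφ, hm⟩ := h
  by_contra! hκ
  have h0 : (0 : Ordinal) < κ := zero_lt_one.trans hκ
  exact (hφ h0 hκ zero_lt_one).ne (hX (hm h0) (hm hκ))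

theorem Ico_add (a κ : Ordinal) : ContainsType κ (Ico a (a + κ)) :=
  ⟨fun o ↦ a + o, fun _ _ _ _ h ↦ by simpa using h,
    fun o ho ↦ ⟨le_self_add, by simpa using ho⟩⟩

/-- Concatenating `κ` many sets containing type `δ` yields type `δ * κ`. -/
theorem mul {δ κ : Ordinal} {Z : Ordinal → Set Ordinal} {W : Set Ordinal}
    (hZ : ∀ i < κ, ContainsType δ (Z i)) (hW : ∀ i < κ, Z i ⊆ W)
    (hlt : ∀ i < κ, ∀ j < κ, i < j → ∀ x ∈ Z i, ∀ y ∈ Z j, x < y) :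
    ContainsType (δ * κ) W := by
  rcases eq_or_ne δ 0 with rfl | hδ
  · exact ⟨id, strictMonoOn_id, fun o ho ↦ by simp at ho⟩
  choose! φ hφ hm using hZ
  have hmod : ∀ o : Ordinal, o % δ ∈ Iio δ := fun o ↦ mod_lt o hδ
  refine ⟨fun o ↦ φ (o / δ) (o % δ), fun o ho o' ho' hoo ↦ ?_, fun o ho ↦ ?_⟩
  · have h1 : o / δ < κ := (lt_mul_iff_div_lt hδ).1 ho
    have h2 : o' / δ < κ := (lt_mul_iff_div_lt hδ).1 ho'
    rcases lt_trichotomy (o / δ) (o' / δ) with h | h | h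
    · exact hlt _ h1 _ h2 h _ (hm _ h1 (hmod o)) _ (hm _ h2 (hmod o'))
    · simp only [h]
      refine hφ _ h2 (hmod o) (hmod o') ?_
      rw [← div_add_mod o δ, ← div_add_mod o' δ, h] at hoo
      simpa using hoo
    · refine absurd hoo (not_lt.2 ?_)
      have h3 : o' < δ * (o / δ) := (lt_mul_iff_div_lt hδ).2 h
      exact h3.le.trans (mul_div_le o δ)
  · have h1 : o / δ < κ := (lt_mul_iff_div_lt hδ).1 ho
    exact hW _ h1 (hm _ h1 (hmod o))

/-- The case of `ω` many sets, indexed by the natural numbers. -/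
theorem mul_omega0 {δ : Ordinal} {Z : ℕ → Set Ordinal} {W : Set Ordinal}
    (hZ : ∀ n, ContainsType δ (Z n)) (hW : ∀ n, Z n ⊆ W)
    (hlt : ∀ m n, m < n → ∀ x ∈ Z m, ∀ y ∈ Z n, x < y) :
    ContainsType (δ * ω) W := by
  refine mul (Z := fun i ↦ {x | ∃ n : ℕ, i = n ∧ x ∈ Z n}) ?_ ?_ ?_
  · intro i hi
    obtain ⟨n, rfl⟩ := lt_omega0.1 hi
    exact (hZ n).mono_set fun x hx ↦ ⟨n, rfl, hx⟩
  · rintro i - x ⟨n, -, hx⟩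
    exact hW n hx
  · rintro i - j - hij x ⟨m, rfl, hx⟩ y ⟨n, rfl, hy⟩
    exact hlt m n (by exact_mod_cast hij) x hx y hy

theorem exists_lt_of_not_opow {δ : Ordinal} (hδ : Order.IsSuccLimit δ) {X : Set Ordinal}
    (h : ¬ ContainsType (ω ^ δ) X) : ∃ ε < δ, ¬ ContainsType (ω ^ ε) X := by
  rw [containsType_iff_le_otype, not_le, lt_lift_iff] at h
  obtain ⟨c, hcX, hc⟩ := h
  obtain ⟨ε, hε, hcε⟩ := (lt_opow_of_isSuccLimit omega0_ne_zero hδ).1 hcX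
  refine ⟨ε, hε, ?_⟩
  rw [containsType_iff_le_otype, not_le, ← hc]
  exact lift_lt.2 hcε

theorem union_opow (δ : Ordinal) : ∀ {X Y : Set Ordinal}, ContainsType (ω ^ δ) (X ∪ Y) →
    ContainsType (ω ^ δ) X ∨ ContainsType (ω ^ δ) Y := by
  induction δ using Ordinal.limitRecOn with
  | zero =>
    rintro X Y ⟨φ, -, hm⟩
    have key : ∀ Z : Set Ordinal, φ 0 ∈ Z → ContainsType (ω ^ (0 : Ordinal)) Z := by
      refine fun Z hZ ↦ ⟨φ, fun a ha b hb hab ↦ ?_, fun a ha ↦ ?_⟩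
      · simp at ha hb
        simp [ha, hb] at hab
      · simp at ha
        simpa [ha] using hZ
    exact (hm (by simp : (0 : Ordinal) ∈ _)).imp (key X) (key Y)
  | add_one δ ih =>
    rintro X Y ⟨φ, hφ, hm⟩
    rw [opow_add_one] at hφ hm ⊢
    set ρ := ω ^ δ with hρ
    let I : ℕ → Set Ordinal := fun n ↦ φ '' Ico (ρ * n) (ρ * n + ρ)
    have hsub : ∀ n : ℕ, Ico (ρ * n) (ρ * n + ρ) ⊆ Iio (ρ * ω) := fun n x hx ↦
      hx.2.trans_le <| by
        rw [← mul_add_one]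
        exact mul_le_mul_right (by exact_mod_cast (natCast_lt_omega0 (n + 1)).le) ρ
    have hI : ∀ n, ContainsType ρ (X ∩ I n) ∨ ContainsType ρ (Y ∩ I n) := fun n ↦ by
      apply ih
      obtain ⟨ψ, hψ, hψm⟩ := Ico_add (ρ * n) ρ
      refine ⟨φ ∘ ψ, (hφ.comp hψ (hψm.mono_right (hsub n))), fun o ho ↦ ?_⟩
      rw [← union_inter_distrib_right]
      exact ⟨hm (hsub n (hψm ho)), mem_image_of_mem φ (hψm ho)⟩
    have hIlt : ∀ m n, m < n → ∀ x ∈ I m, ∀ y ∈ I n, x < y := by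
      rintro m n hmn _ ⟨x, hx, rfl⟩ _ ⟨y, hy, rfl⟩
      refine hφ (hsub m hx) (hsub n hy) (hx.2.trans_le (le_trans ?_ hy.1))
      rw [← mul_add_one]
      exact mul_le_mul_right (by exact_mod_cast hmn) ρ
    have key : ∀ Z : Set Ordinal, {n | ContainsType ρ (Z ∩ I n)}.Infinite →
        ContainsType (ρ * ω) Z := fun Z hZ ↦
      mul_omega0 (Z := fun n ↦ Z ∩ I (Nat.nth (fun n ↦ ContainsType ρ (Z ∩ I n)) n))
        (fun n ↦ Nat.nth_mem_of_infinite hZ n) (fun n ↦ inter_subset_left)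
        fun m n hmn x hx y hy ↦ hIlt _ _ (Nat.nth_strictMono hZ hmn) x hx.2 y hy.2
    by_contra! hcon
    have hfin := (not_infinite.1 (mt (key X) hcon.1)).union (not_infinite.1 (mt (key Y) hcon.2))
    exact infinite_univ (hfin.subset fun n _ ↦ hI n)
  | limit δ hδ ih =>
    intro X Y h
    by_contra! hcon
    obtain ⟨ε₁, h₁, hX⟩ := exists_lt_of_not_opow hδ hcon.1
    obtain ⟨ε₂, h₂, hY⟩ := exists_lt_of_not_opow hδ hcon.2
    have hpow : ∀ {a b : Ordinal}, a ≤ b → ω ^ a ≤ ω ^ b :=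
      fun hab ↦ opow_le_opow_right omega0_pos hab
    rcases ih (max ε₁ ε₂) (max_lt h₁ h₂) (h.mono_type (hpow (max_lt h₁ h₂).le)) with h' | h'
    · exact hX (h'.mono_type (hpow (le_max_left _ _)))
    · exact hY (h'.mono_type (hpow (le_max_right _ _)))

/-- Pigeonhole for indecomposable order types. -/
theorem union {α : Ordinal} (hα : IsPrincipal (· + ·) α) {X Y : Set Ordinal}
    (h : ContainsType α (X ∪ Y)) : ContainsType α X ∨ ContainsType α Y := by
  rcases isPrincipal_add_iff_zero_or_omega0_opow.1 hα with rfl | ⟨δ, rfl⟩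
  · exact .inl ⟨id, strictMonoOn_id, fun o ho ↦ by simp at ho⟩
  · exact union_opow δ h

theorem biUnion {ι : Type*} {α : Ordinal} (hα : IsPrincipal (· + ·) α) (hα0 : α ≠ 0)
    {s : Set ι} (hs : s.Finite) {X : ι → Set Ordinal} (h : ContainsType α (⋃ i ∈ s, X i)) :
    ∃ i ∈ s, ContainsType α (X i) := by
  induction s, hs using Set.Finite.induction_on with
  | empty =>
    obtain ⟨φ, -, hm⟩ := h
    simpa using hm (show (0 : Ordinal) ∈ Iio α from pos_iff_ne_zero.2 hα0)
  | @insert a s _ _ ih =>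
    rw [biUnion_insert] at h
    rcases union hα h with h | h
    · exact ⟨a, mem_insert _ _, h⟩
    · obtain ⟨i, hi, h⟩ := ih h
      exact ⟨i, mem_insert_of_mem _ hi, h⟩

end ContainsType

theorem containsType_omega0_of_infinite {X : Set Ordinal} (hX : X.Infinite) :
    ContainsType ω X := by
  rw [containsType_iff_le_otype, lift_omega0, ← aleph0_le_card, otype, card_type]
  exact Cardinal.infinite_iff.1 hX.to_subtype

/-- Some strictly increasing self-map of `[a, b)` takes values in `M` and fixes the points of `F`. -/
def EmbedsFixing (F : Set Ordinal.{0}) (a b : Ordinal.{0}) (M : Set Ordinal.{0}) : Prop :=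
  ∃ h : Ordinal → Ordinal, StrictMonoOn h (Ico a b) ∧ MapsTo h (Ico a b) (M ∩ Ico a b) ∧
    ∀ i ∈ F, i ∈ Ico a b → h i = i

/-- Finitely many ultrafilters suffice to witness `EmbedsFixing F a b`. -/
def FinitelyWitnessed (F : Set Ordinal.{0}) (a b : Ordinal.{0}) : Prop :=
  ∃ 𝒰 : Set (Ultrafilter Ordinal.{0}), 𝒰.Finite ∧
    ∀ M : Set Ordinal, (∀ U ∈ 𝒰, M ∈ U) → EmbedsFixing F a b M

theorem EmbedsFixing.append {F : Set Ordinal} {a b c : Ordinal} (hab : a ≤ b) (hbc : b ≤ c)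
    {M : Set Ordinal} (h₁ : EmbedsFixing F a b M) (h₂ : EmbedsFixing F b c M) :
    EmbedsFixing F a c M := by
  obtain ⟨g, hg, hgm, hgF⟩ := h₁
  obtain ⟨h, hh, hhm, hhF⟩ := h₂
  refine ⟨fun i ↦ if i < b then g i else h i, fun i hi j hj hij ↦ ?_, fun i hi ↦ ?_,
    fun i hiF hi ↦ ?_⟩
  · by_cases hib : i < b <;> by_cases hjb : j < b
    · simpa [hib, hjb] using hg ⟨hi.1, hib⟩ ⟨hj.1, hjb⟩ hij
    · simpa [hib, hjb] using
        (hgm ⟨hi.1, hib⟩).2.2.trans_le (hhm ⟨not_lt.1 hjb, hj.2⟩).2.1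
    · exact absurd (hij.trans hjb) hib
    · simpa [hib, hjb] using hh ⟨not_lt.1 hib, hi.2⟩ ⟨not_lt.1 hjb, hj.2⟩ hij
  · by_cases hib : i < b
    · have := hgm ⟨hi.1, hib⟩
      simpa [hib] using And.intro this.1 ⟨this.2.1, this.2.2.trans_le hbc⟩
    · have := hhm ⟨not_lt.1 hib, hi.2⟩
      simpa [hib] using And.intro this.1 ⟨hab.trans this.2.1, this.2.2⟩
  · by_cases hib : i < b
    · simpa [hib] using hgF i hiF ⟨hi.1, hib⟩
    · simpa [hib] using hhF i hiF ⟨not_lt.1 hib, hi.2⟩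

namespace FinitelyWitnessed

theorem append {F : Set Ordinal} {a b c : Ordinal} (hab : a ≤ b) (hbc : b ≤ c)
    (h₁ : FinitelyWitnessed F a b) (h₂ : FinitelyWitnessed F b c) : FinitelyWitnessed F a c := by
  obtain ⟨𝒰, h𝒰, h₁⟩ := h₁
  obtain ⟨𝒱, h𝒱, h₂⟩ := h₂
  exact ⟨𝒰 ∪ 𝒱, h𝒰.union h𝒱, fun M hM ↦
    (h₁ M fun U hU ↦ hM U (.inl hU)).append hab hbc (h₂ M fun U hU ↦ hM U (.inr hU))⟩

theorem add_of_isPrincipal {F : Set Ordinal} {a κ : Ordinal} (hκ : IsPrincipal (· + ·) κ)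
    (hκ0 : κ ≠ 0) (hF : ∀ i ∈ F, i ∉ Ico a (a + κ)) : FinitelyWitnessed F a (a + κ) := by
  let l : Filter Ordinal.{0} :=
    { sets := {S | ¬ ContainsType κ (Ico a (a + κ) \ S)}
      univ_sets := by
        rintro ⟨φ, -, hm⟩
        simpa using hm (show (0 : Ordinal) ∈ Iio κ from pos_iff_ne_zero.2 hκ0)
      sets_of_superset := fun hS hST hT ↦ hS (hT.mono_set (sdiff_subset_sdiff_right hST))
      inter_sets := fun hS hT h ↦ by
        rw [sdiff_inter] at h
        exact (h.union hκ).elim hS hT }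
  have hl : l.NeBot := ⟨fun h ↦ by
    have h0 : ∅ ∈ l := h ▸ Filter.mem_bot
    exact h0 (by simpa using ContainsType.Ico_add a κ)⟩
  refine ⟨{Ultrafilter.of l}, finite_singleton _, fun M hM ↦ ?_⟩
  have hMU : M ∈ Ultrafilter.of l := hM _ rfl
  have hMκ : ContainsType κ (M ∩ Ico a (a + κ)) := by
    by_contra hcon
    have hc : Mᶜ ∈ l := fun h ↦ hcon (by rwa [sdiff_compl, inter_comm] at h)
    exact Ultrafilter.compl_mem_iff_notMem.1 (Ultrafilter.of_le l hc) hMU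
  obtain ⟨φ, hφ, hm⟩ := hMκ
  have hsub : ∀ i ∈ Ico a (a + κ), i - a ∈ Iio κ := fun i hi ↦
    (Ordinal.sub_lt_of_le hi.1).2 hi.2
  refine ⟨fun i ↦ φ (i - a), fun i hi j hj hij ↦ hφ (hsub i hi) (hsub j hj) ?_,
    fun i hi ↦ hm (hsub i hi), fun i hiF hi ↦ absurd hi (hF i hiF)⟩
  rwa [Ordinal.sub_lt_of_le hi.1, Ordinal.add_sub_cancel_of_le hj.1]

theorem add_of_disjoint {F : Set Ordinal} (κ : Ordinal) : ∀ {a : Ordinal},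
    (∀ i ∈ F, i ∉ Ico a (a + κ)) → FinitelyWitnessed F a (a + κ) := by
  induction κ using WellFoundedLT.induction with
  | ind κ ih =>
    intro a hF
    rcases eq_or_ne κ 0 with rfl | hκ0
    · exact ⟨∅, finite_empty, fun M _ ↦ ⟨id, strictMonoOn_id, fun i hi ↦ by simp at hi, by simp⟩⟩
    by_cases hκ : IsPrincipal (· + ·) κ
    · exact add_of_isPrincipal hκ hκ0 hF
    · obtain ⟨b, hb, c, hc, rfl⟩ := exists_lt_add_of_not_isPrincipal_add hκ
      rw [← add_assoc] at hF ⊢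
      exact append le_self_add le_self_add
        (ih b hb fun i hi h ↦ hF i hi ⟨h.1, h.2.trans_le le_self_add⟩)
        (ih c hc fun i hi h ↦ hF i hi ⟨le_self_add.trans h.1, h.2⟩)

theorem add_one (F : Set Ordinal) (p : Ordinal) : FinitelyWitnessed F p (p + 1) := by
  refine ⟨{pure p}, finite_singleton _, fun M hM ↦ ⟨id, strictMonoOn_id, fun i hi ↦ ?_, by simp⟩⟩
  have hip : i = p := le_antisymm (Order.lt_add_one_iff.1 hi.2) hi.1
  exact ⟨hip ▸ hM _ rfl, hi⟩

theorem mono_set {F G : Set Ordinal} {a b : Ordinal} (h : FinitelyWitnessed F a b)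
    (hG : ∀ i ∈ G, i ∈ Ico a b → i ∈ F) : FinitelyWitnessed G a b := by
  obtain ⟨𝒰, h𝒰, h⟩ := h
  refine ⟨𝒰, h𝒰, fun M hM ↦ ?_⟩
  obtain ⟨g, hg, hgm, hgF⟩ := h M hM
  exact ⟨g, hg, hgm, fun i hi hab ↦ hgF i (hG i hi hab) hab⟩

theorem of_finset (F : Finset Ordinal.{0}) : ∀ b, FinitelyWitnessed (F : Set Ordinal) 0 b := by
  induction F using Finset.induction_on_max with
  | empty =>
    intro b
    simpa using add_of_disjoint (F := ∅) b (a := 0) (by simp)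
  | insert p F hF ih =>
    intro b
    rcases le_or_gt b p with hb | hb
    · refine (ih b).mono_set fun i hi hib ↦ ?_
      rcases Finset.mem_insert.1 (Finset.mem_coe.1 hi) with rfl | hi
      · exact absurd hib.2 hb.not_gt
      · exact hi
    · have hb' : p + 1 ≤ b := Order.add_one_le_of_lt hb
      refine append zero_le hb.le ((ih p).mono_set fun i hi hip ↦ ?_)
        (append le_self_add hb' (add_one _ p) ?_)
      · rcases Finset.mem_insert.1 (Finset.mem_coe.1 hi) with rfl | hi
        · exact absurd hip.2 (lt_irrefl _)
        · exact hi
      · rw [← Ordinal.add_sub_cancel_of_le hb']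
        refine add_of_disjoint _ fun i hi hib ↦ ?_
        have hpi : p < i := Order.add_one_le_iff.1 hib.1
        rcases Finset.mem_insert.1 (Finset.mem_coe.1 hi) with rfl | hi
        · exact lt_irrefl _ hpi
        · exact hpi.not_gt (hF i hi)

end FinitelyWitnessed

theorem MonoColor.mono {f : Finset Ordinal → Fin 2} {S T : Set Ordinal} {c : Fin 2}
    (h : MonoColor f T c) (hST : S ⊆ T) : MonoColor f S c :=
  fun x hx y hy ↦ h x (hST hx) y (hST hy)

theorem otype_coe_finset (s : Finset Ordinal.{0}) : otype s = s.card := by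
  rw [otype, ← card_eq_nat, card_type]
  simp

theorem exists_finset_of_otype_eq {B : Set Ordinal.{0}} {n : ℕ} (h : otype B = n) :
    ∃ s : Finset Ordinal, (s : Set Ordinal) = B ∧ s.card = n := by
  rw [otype, ← card_eq_nat, card_type] at h
  exact Cardinal.mk_set_eq_nat_iff_finset.1 h

/-- A partition relation transfers from `Iio α` to any set containing type `α`. -/
theorem PartRel.exists_of_containsType {α γ : Ordinal} {k : ℕ} (h : PartRel α k γ)
    (f : Finset Ordinal → Fin 2) {D : Set Ordinal} (hD : ContainsType α D) :
    (∃ s : Finset Ordinal, s.card = k ∧ (s : Set Ordinal) ⊆ D ∧ MonoColor f s 0) ∨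
    ∃ C ⊆ D, ContainsType γ C ∧ MonoColor f C 1 := by
  obtain ⟨φ, hφ, hm⟩ := hD
  have key : ∀ (B : Set Ordinal) (c : Fin 2), B ⊆ Iio α →
      MonoColor (fun s ↦ f (s.image φ)) B c → MonoColor f (φ '' B) c := by
    rintro B c - hB _ ⟨x, hx, rfl⟩ _ ⟨y, hy, rfl⟩ hxy
    simpa using hB x hx y hy fun h ↦ hxy (h ▸ rfl)
  rcases h fun s ↦ f (s.image φ) with ⟨B, hBα, hB, hBf⟩ | ⟨C, hCα, hC, hCf⟩
  · rw [lift_natCast] at hB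
    obtain ⟨s, rfl, hs⟩ := exists_finset_of_otype_eq hB
    refine .inl ⟨s.image φ, ?_, ?_, ?_⟩
    · rw [Finset.card_image_of_injOn (hφ.injOn.mono hBα), hs]
    · rw [Finset.coe_image]
      exact (hm.mono_left hBα).image_subset
    · rw [Finset.coe_image]
      exact key _ _ hBα hBf
  · refine .inr ⟨φ '' C, (hm.mono_left hCα).image_subset, ?_, key _ _ hCα hCf⟩
    obtain ⟨ψ, hψ, hψm⟩ := containsType_iff_le_otype.2 hC.ge
    exact ⟨φ ∘ ψ, hφ.comp hψ (hψm.mono_right hCα), fun o ho ↦ mem_image_of_mem φ (hψm ho)⟩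

section Step

variable {f : Finset Ordinal.{0} → Fin 2} {S : Set Ordinal.{0}} {α β : Ordinal.{0}} {k : ℕ}

/-- If every subset of `S` containing type `α` has a `0`-homogeneous `k`-subset and `S` has no
`0`-homogeneous `2k`-subset, then for every `E ⊆ S` containing type `α`, each `0`-homogeneous
`k`-subset of `S` has an element whose `1`-neighbourhood in `E` contains type `α`. -/
theorem exists_containsType_neighbors (hα : IsPrincipal (· + ·) α) (hα1 : 1 < α)
    (hred : ∀ D ⊆ S, ContainsType α D →
      ∃ s : Finset Ordinal, s.card = k ∧ (s : Set Ordinal) ⊆ D ∧ MonoColor f s 0)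
    (hno : ∀ s : Finset Ordinal, (s : Set Ordinal) ⊆ S → s.card = 2 * k → ¬ MonoColor f s 0)
    {E : Set Ordinal} (hES : E ⊆ S) (hE : ContainsType α E) {s : Finset Ordinal}
    (hsS : (s : Set Ordinal) ⊆ S) (hs : s.card = k) (hsf : MonoColor f s 0) :
    ∃ x ∈ s, ContainsType α (E ∩ {y | y ≠ x ∧ f {x, y} = 1}) := by
  by_contra! hcon
  set N : Ordinal → Set Ordinal := fun x ↦ {y | y ≠ x ∧ f {x, y} = 1} with hN
  have hcover : E ⊆ (E \ ⋃ x ∈ (s : Set Ordinal), (E ∩ N x ∪ {x})) ∪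
      ⋃ x ∈ (s : Set Ordinal), (E ∩ N x ∪ {x}) := by
    rw [sdiff_union_self]
    exact subset_union_left
  rcases (hE.mono_set hcover).union hα with h | h
  · obtain ⟨t, ht, htE, htf⟩ := hred _ (sdiff_subset.trans hES) h
    have hst : ∀ x ∈ s, ∀ y ∈ t, x ≠ y ∧ f {x, y} = 0 := by
      intro x hx y hy
      have hy' := htE hy
      simp only [hN, mem_sdiff, mem_iUnion, mem_union, mem_inter_iff, mem_ofPred_eq,
        mem_singleton_iff, not_exists, not_or, not_and, Finset.mem_coe] at hy'
      obtain ⟨h1, h2⟩ := hy'.2 x hx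
      exact ⟨fun h ↦ h2 h.symm, by have := h1 hy'.1 h2; omega⟩
    have hdisj : Disjoint s t := Finset.disjoint_left.2 fun x hx hxt ↦ (hst x hx x hxt).1 rfl
    refine hno (s ∪ t) ?_ ?_ ?_
    · rw [Finset.coe_union]
      exact union_subset hsS (htE.trans (sdiff_subset.trans hES))
    · rw [Finset.card_union_of_disjoint hdisj, hs, ht, two_mul]
    · intro x hx y hy hxy
      rw [Finset.coe_union] at hx hy
      rcases hx with hx | hx <;> rcases hy with hy | hy
      · exact hsf x hx y hy hxy
      · exact (hst x hx y hy).2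
      · rw [Finset.pair_comm]
        exact (hst y hy x hx).2
      · exact htf x hx y hy hxy
  · obtain ⟨x, hx, h⟩ := h.biUnion hα hα1.ne_bot s.finite_toSet
    rcases h.union hα with h | h
    · exact hcon x hx h
    · exact hα1.not_ge (h.of_subsingleton subsingleton_singleton)

/-- Given sets `A i` (`i < β`) and `D` containing type `α`, some `x ∈ D` has large `1`-neighbourhoods
in a reindexed subfamily `A (h i)` of order type `β`, where `h` fixes prescribed indices `F`. -/
theorem exists_point_shrinking (hα : IsPrincipal (· + ·) α) (hα1 : 1 < α)
    (hred : ∀ D ⊆ S, ContainsType α D →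
      ∃ s : Finset Ordinal, s.card = k ∧ (s : Set Ordinal) ⊆ D ∧ MonoColor f s 0)
    (hno : ∀ s : Finset Ordinal, (s : Set Ordinal) ⊆ S → s.card = 2 * k → ¬ MonoColor f s 0)
    {A : Ordinal → Set Ordinal} (hA : ∀ i < β, A i ⊆ S ∧ ContainsType α (A i))
    {D : Set Ordinal} (hDS : D ⊆ S) (hD : ContainsType α D) (F : Finset Ordinal) :
    ∃ x ∈ D, ∃ h : Ordinal → Ordinal, StrictMonoOn h (Iio β) ∧ MapsTo h (Iio β) (Iio β) ∧
      (∀ i ∈ F, i < β → h i = i) ∧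
      ∀ i < β, ContainsType α (A (h i) ∩ {y | y ≠ x ∧ f {x, y} = 1}) := by
  obtain ⟨𝒰, h𝒰, hemb⟩ := FinitelyWitnessed.of_finset F β
  set M : Ordinal → Set Ordinal :=
    fun x ↦ {i | i < β → ContainsType α (A i ∩ {y | y ≠ x ∧ f {x, y} = 1})} with hM
  obtain ⟨x, hx, hxM⟩ : ∃ x ∈ D, ∀ U ∈ 𝒰, M x ∈ U := by
    by_contra! hcon
    have hcover : D ⊆ ⋃ U ∈ 𝒰, {x | x ∈ D ∧ M x ∉ U} := fun x hx ↦ by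
      obtain ⟨U, hU, hxU⟩ := hcon x hx
      exact mem_biUnion hU ⟨hx, hxU⟩
    obtain ⟨U, hU, hDU⟩ := (hD.mono_set hcover).biUnion hα hα1.ne_bot h𝒰
    obtain ⟨s, hs, hsD, hsf⟩ := hred _ (fun x hx ↦ hDS hx.1) hDU
    have hinter : (⋂ x ∈ s, (M x)ᶜ) ∈ U := (Filter.biInter_finset_mem s).2 fun x hx ↦
      Ultrafilter.compl_mem_iff_notMem.2 (hsD hx).2
    obtain ⟨i, hi⟩ := U.nonempty_of_mem hinter
    have hi' : ∀ x ∈ s, i < β ∧ ¬ ContainsType α (A i ∩ {y | y ≠ x ∧ f {x, y} = 1}) := by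
      simpa [hM] using hi
    have hsne : s.Nonempty := by
      by_contra hse
      rw [Finset.not_nonempty_iff_eq_empty] at hse
      subst hse
      refine hno ∅ (by simp) ?_ hsf
      simp [← hs]
    have hiβ : i < β := (hi' _ hsne.choose_spec).1
    obtain ⟨x, hx, h⟩ := exists_containsType_neighbors hα hα1 hred hno (hA i hiβ).1 (hA i hiβ).2
      (fun x hx ↦ hDS (hsD hx).1) hs hsf
    exact (hi' x hx).2 h
  obtain ⟨h, hh, hhm, hhF⟩ := hemb (M x) hxM
  have hIco : Ico 0 β = Iio β := by ext; simp
  rw [hIco] at hh hhm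
  exact ⟨x, hx, h, hh, fun i hi ↦ (hhm hi).2, fun i hi hiβ ↦ hhF i hi ⟨zero_le, hiβ⟩,
    fun i hi ↦ (hhm hi).1 (hhm hi).2⟩

/-- Greedy construction of a `1`-homogeneous set of type `ω * β`, choosing infinitely many points
for each of the countably many positions `i < β`. -/
theorem exists_monoColor_one (hα : IsPrincipal (· + ·) α) (hα1 : 1 < α) (hβ0 : β ≠ 0)
    (hβ : (Iio β).Countable)
    (hred : ∀ D ⊆ S, ContainsType α D →
      ∃ s : Finset Ordinal, s.card = k ∧ (s : Set Ordinal) ⊆ D ∧ MonoColor f s 0)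
    (hno : ∀ s : Finset Ordinal, (s : Set Ordinal) ⊆ S → s.card = 2 * k → ¬ MonoColor f s 0)
    {A : Ordinal → Set Ordinal} (hA : ∀ i < β, A i ⊆ S ∧ ContainsType α (A i))
    (hAlt : ∀ i < β, ∀ j < β, i < j → ∀ x ∈ A i, ∀ y ∈ A j, x < y) :
    ∃ C ⊆ S, ContainsType (ω * β) C ∧ MonoColor f C 1 := by
  obtain ⟨e, he⟩ := hβ.exists_eq_range ⟨0, pos_iff_ne_zero.2 hβ0⟩
  have heβ : ∀ n, e n < β := fun n ↦ he.ge (mem_range_self n)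
  set p : ℕ → Ordinal := fun n ↦ e n.unpair.1 with hp
  set F : ℕ → Finset Ordinal := fun n ↦ (Finset.range (n + 1)).image e with hF
  have hFmono : Monotone F := fun m n hmn ↦ Finset.image_subset_image <|
    Finset.range_subset_range.2 (Nat.succ_le_succ hmn)
  have hpF : ∀ n, p n ∈ F n := fun n ↦ Finset.mem_image_of_mem e <|
    Finset.mem_range.2 (Nat.lt_succ_of_le n.unpair_left_le)
  have hpβ : ∀ n, p n < β := fun n ↦ heβ _
  let St := {A : Ordinal.{0} → Set Ordinal.{0} // (∀ i < β, A i ⊆ S ∧ ContainsType α (A i)) ∧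
    ∀ i < β, ∀ j < β, i < j → ∀ x ∈ A i, ∀ y ∈ A j, x < y}
  have hstep : ∀ (n : ℕ) (A : St), ∃ (x : Ordinal) (A' : St), x ∈ A.1 (p n) ∧
      ∃ h : Ordinal → Ordinal, StrictMonoOn h (Iio β) ∧ MapsTo h (Iio β) (Iio β) ∧
        (∀ i ∈ F n, i < β → h i = i) ∧
        ∀ i < β, A'.1 i ⊆ A.1 (h i) ∩ {y | y ≠ x ∧ f {x, y} = 1} := by
    rintro n ⟨A, hA, hAlt⟩
    obtain ⟨x, hx, h, hh, hhm, hhF, hhA⟩ := exists_point_shrinking hα hα1 hred hno hA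
      (hA _ (hpβ n)).1 (hA _ (hpβ n)).2 (F n)
    refine ⟨x, ⟨fun i ↦ A (h i) ∩ {y | y ≠ x ∧ f {x, y} = 1}, fun i hi ↦
      ⟨inter_subset_left.trans (hA _ (hhm hi)).1, hhA i hi⟩, fun i hi j hj hij x hx y hy ↦
      hAlt _ (hhm hi) _ (hhm hj) (hh hi hj hij) x hx.1 y hy.1⟩, hx, h, hh, hhm, hhF,
      fun i _ ↦ subset_rfl⟩
  choose nextPt nextSt hmem hnext using hstep
  let st : ℕ → St := fun n ↦ Nat.rec ⟨A, hA, hAlt⟩ nextSt n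
  set x : ℕ → Ordinal := fun n ↦ nextPt n (st n) with hx
  have hxmem : ∀ n, x n ∈ (st n).1 (p n) := fun n ↦ hmem n (st n)
  have hst : ∀ n, ∃ h : Ordinal → Ordinal, StrictMonoOn h (Iio β) ∧ MapsTo h (Iio β) (Iio β) ∧
      (∀ i ∈ F n, i < β → h i = i) ∧
      ∀ i < β, (st (n + 1)).1 i ⊆ (st n).1 (h i) ∩ {y | y ≠ x n ∧ f {x n, y} = 1} :=
    fun n ↦ hnext n (st n)
  have hle : ∀ n m, n ≤ m → ∃ h : Ordinal → Ordinal, StrictMonoOn h (Iio β) ∧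
      MapsTo h (Iio β) (Iio β) ∧ (∀ i ∈ F n, i < β → h i = i) ∧
      ∀ i < β, (st m).1 i ⊆ (st n).1 (h i) := by
    intro n m hnm
    induction m, hnm using Nat.le_induction with
    | base => exact ⟨id, strictMonoOn_id, mapsTo_id _, fun _ _ _ ↦ rfl, fun _ _ ↦ subset_rfl⟩
    | succ m hnm ih =>
      obtain ⟨g, hg, hgm, hgF, hgst⟩ := ih
      obtain ⟨h, hh, hhm, hhF, hhst⟩ := hst m
      refine ⟨g ∘ h, hg.comp hh hhm, hgm.comp hhm, fun i hi hiβ ↦ ?_, fun i hi ↦ ?_⟩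
      · rw [Function.comp_apply, hhF i (hFmono hnm hi) hiβ, hgF i hi hiβ]
      · exact (hhst i hi).trans (inter_subset_left.trans (hgst _ (hhm hi)))
  have hone : ∀ n m, n < m → x m ≠ x n ∧ f {x n, x m} = 1 := by
    intro n m hnm
    obtain ⟨g, -, hgm, -, hgst⟩ := hle (n + 1) m hnm
    obtain ⟨h, -, -, -, hhst⟩ := hst n
    exact (hhst _ (hgm (hpβ m)) (hgst _ (hpβ m) (hxmem m))).2
  have hord : ∀ n m, p n < p m → x n < x m := by
    intro n m hnm
    rcases le_total n m with h | h
    · obtain ⟨g, hg, hgm, hgF, hgst⟩ := hle n m h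
      refine (st n).2.2 _ (hpβ n) _ (hgm (hpβ m)) ?_ _ (hxmem n) _ (hgst _ (hpβ m) (hxmem m))
      simpa [hgF _ (hpF n) (hpβ n)] using hg (hpβ n) (hpβ m) hnm
    · obtain ⟨g, hg, hgm, hgF, hgst⟩ := hle m n h
      refine (st m).2.2 _ (hgm (hpβ n)) _ (hpβ m) ?_ _ (hgst _ (hpβ n) (hxmem n)) _ (hxmem m)
      simpa [hgF _ (hpF m) (hpβ m)] using hg (hpβ n) (hpβ m) hnm
  have hinj : Function.Injective x := by
    intro n m hnm
    by_contra hne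
    rcases lt_or_gt_of_ne hne with h | h
    · exact (hone n m h).1 hnm.symm
    · exact (hone m n h).1 hnm
  refine ⟨range x, ?_, ?_, ?_⟩
  · rintro _ ⟨n, rfl⟩
    exact ((st n).2.1 _ (hpβ n)).1 (hxmem n)
  · refine ContainsType.mul (Z := fun i ↦ x '' {n | p n = i}) (fun i hi ↦ ?_)
      (fun i _ ↦ image_subset_range _ _) ?_
    · obtain ⟨m, rfl⟩ : i ∈ range e := he ▸ hi
      refine containsType_omega0_of_infinite (Infinite.image hinj.injOn ?_)
      refine infinite_of_injective_forall_mem (f := fun j ↦ Nat.pair m j)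
        (fun a b hab ↦ (Nat.pair_eq_pair.1 hab).2) fun j ↦ ?_
      simp [hp]
    · rintro i - j - hij _ ⟨n, rfl, rfl⟩ _ ⟨m, rfl, rfl⟩
      exact hord n m hij
  · rintro _ ⟨n, rfl⟩ _ ⟨m, rfl⟩ hnm
    rcases lt_trichotomy n m with h | rfl | h
    · exact (hone n m h).2
    · exact absurd rfl hnm
    · rw [Finset.pair_comm]
      exact (hone m n h).2

end Step

theorem stmt11 (α β γ : Ordinal) (k : ℕ) (hα : Indecomp α)
    (hβ : β < (Cardinal.aleph 1).ord) (hk : 1 < k)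
    (h : PartRel α k γ) :
    PartRel (α * β) (2 * k : ℕ) (min γ (Ordinal.omega0 * β)) := by
  have hα' : IsPrincipal (· + ·) α := fun a b ha hb ↦ hα a ha b hb
  intro f
  by_contra hcon
  obtain ⟨h0, h1⟩ := not_or.1 hcon
  have hno : ∀ s : Finset Ordinal, (s : Set Ordinal) ⊆ Iio (α * β) → s.card = 2 * k →
      ¬ MonoColor f s 0 := fun s hs hcard hf ↦
    h0 ⟨s, hs, by rw [otype_coe_finset, hcard, lift_natCast], hf⟩
  have hone : ∀ C ⊆ Iio (α * β), ContainsType (min γ (ω * β)) C → ¬ MonoColor f C 1 := by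
    rintro C hC ⟨φ, hφ, hm⟩ hf
    exact h1 ⟨φ '' _, hm.image_subset.trans hC, otype_image hφ, hf.mono hm.image_subset⟩
  have hred : ∀ D ⊆ Iio (α * β), ContainsType α D →
      ∃ s : Finset Ordinal, s.card = k ∧ (s : Set Ordinal) ⊆ D ∧ MonoColor f s 0 :=
    fun D hD hDα ↦ (h.exists_of_containsType f hDα).resolve_right fun ⟨C, hCD, hC, hCf⟩ ↦
      hone C (hCD.trans hD) (hC.mono_type (min_le_left _ _)) hCf
  have hβ0 : β ≠ 0 := by
    rintro rfl
    refine hone ∅ (empty_subset _) ⟨id, strictMonoOn_id, fun o ho ↦ ?_⟩ (by simp [MonoColor])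
    simp at ho
  have hblock : ∀ i < β, Ico (α * i) (α * i + α) ⊆ Iio (α * β) := fun i hi x hx ↦
    hx.2.trans_le <| by
      rw [← mul_add_one]
      exact mul_le_mul_right (Order.add_one_le_of_lt hi) α
  have hα1 : 1 < α := by
    have hI := ContainsType.Ico_add (α * 0) α
    obtain ⟨s, hs, hsα, -⟩ := hred _ (hblock 0 (pos_iff_ne_zero.2 hβ0)) hI
    simp only [mul_zero, zero_add] at hsα
    by_contra! hle
    have hs1 : s.card ≤ 1 := Finset.card_le_one.2 fun a ha b hb ↦ by
      have ha' := Order.lt_one_iff.1 ((hsα ha).2.trans_le hle)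
      have hb' := Order.lt_one_iff.1 ((hsα hb).2.trans_le hle)
      rw [ha', hb']
    omega
  have hβc : (Iio β).Countable := by
    rw [← Cardinal.le_aleph0_iff_set_countable, Cardinal.mk_Iio_ordinal,
      Cardinal.lift_le_aleph0, ← Order.lt_succ_iff, Cardinal.succ_aleph0]
    exact Cardinal.lt_ord.1 hβ
  obtain ⟨C, hC, hCt, hCf⟩ := exists_monoColor_one hα' hα1 hβ0 hβc hred hno
    (A := fun i ↦ Ico (α * i) (α * i + α))
    (fun i hi ↦ ⟨hblock i hi, ContainsType.Ico_add _ _⟩) fun i _ j _ hij x hx y hy ↦ by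
      refine hx.2.trans_le (le_trans ?_ hy.1)
      rw [← mul_add_one]
      exact mul_le_mul_right (Order.add_one_le_of_lt hij) α
  exact hone C hC (hCt.mono_type (min_le_right _ _)) hCf
end

section
/- The Erdős–Milner theorem: if ν is a countable ordinal and n < ω, then ω^{1+ν·n} → (2ⁿ, ω^{1+ν})². -/
open Ordinal Set

/-- `Y` contains a subset of order type `ρ`. -/
def Large (ρ : Ordinal.{0}) (Y : Set Ordinal.{0}) : Prop :=
  ∃ h : Ordinal.{0} → Ordinal.{0}, StrictMonoOn h (Iio ρ) ∧ MapsTo h (Iio ρ) Y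

namespace Large

variable {ρ σ : Ordinal.{0}} {Y Z : Set Ordinal.{0}}

theorem mono (h : Large ρ Y) (hσ : σ ≤ ρ) (hYZ : Y ⊆ Z) : Large σ Z := by
  obtain ⟨e, he, hm⟩ := h
  exact ⟨e, he.mono (Iio_subset_Iio hσ), fun x hx => hYZ (hm (Iio_subset_Iio hσ hx))⟩

theorem zero (Y : Set Ordinal.{0}) : Large 0 Y :=
  ⟨id, fun _ h => absurd (mem_Iio.1 h) not_lt_zero, fun _ h => absurd (mem_Iio.1 h) not_lt_zero⟩

theorem image {e : Ordinal.{0} → Ordinal.{0}} (he : StrictMonoOn e (Iio ρ)) :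
    Large ρ (e '' Iio ρ) :=
  ⟨e, he, fun x hx => ⟨x, hx, rfl⟩⟩

theorem image_of_large {e : Ordinal.{0} → Ordinal.{0}} (he : StrictMonoOn e Y) (h : Large ρ Y) :
    Large ρ (e '' Y) := by
  obtain ⟨g, hg, hm⟩ := h
  exact ⟨e ∘ g, fun x hx y hy hxy => he (hm hx) (hm hy) (hg hx hy hxy),
    fun x hx => ⟨g x, hm hx, rfl⟩⟩

theorem Ico (c ρ : Ordinal.{0}) : Large ρ (Ico c (c + ρ)) :=
  ⟨fun x => c + x, fun x _ y _ h => by simpa using h, fun x hx => by simpa using hx⟩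

theorem nonempty (h : Large ρ Y) (hρ : ρ ≠ 0) : Y.Nonempty := by
  obtain ⟨e, -, hm⟩ := h
  exact ⟨e 0, hm (pos_iff_ne_zero.2 hρ)⟩

theorem one_of_mem {x : Ordinal.{0}} (hx : x ∈ Y) : Large 1 Y :=
  ⟨fun _ => x, fun a ha b hb hab => by simp_all, fun _ _ => hx⟩

theorem add_of_forall_lt (hY : Large ρ Y) (hZ : Large σ Z) (hlt : ∀ y ∈ Y, ∀ z ∈ Z, y < z) :
    Large (ρ + σ) (Y ∪ Z) := by
  obtain ⟨g, hg, hgm⟩ := hY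
  obtain ⟨k, hk, hkm⟩ := hZ
  have aux : ∀ x, x < ρ + σ → ¬ x < ρ → x - ρ < σ := fun x hx hx' => by
    rw [← add_lt_add_iff_left ρ, Ordinal.add_sub_cancel_of_le (not_lt.1 hx')]; exact hx
  refine ⟨fun x => if x < ρ then g x else k (x - ρ), fun x hx y hy hxy => ?_, fun x hx => ?_⟩
  · dsimp only
    split_ifs with h1 h2 h2
    · exact hg h1 h2 hxy
    · exact hlt _ (hgm h1) _ (hkm (aux y hy h2))
    · exact absurd (hxy.trans h2) h1
    · refine hk (aux x hx h1) (aux y hy h2) ?_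
      rw [← add_lt_add_iff_left ρ, Ordinal.add_sub_cancel_of_le (not_lt.1 h1),
        Ordinal.add_sub_cancel_of_le (not_lt.1 h2)]
      exact hxy
  · dsimp only
    split_ifs with h1
    · exact Or.inl (hgm h1)
    · exact Or.inr (hkm (aux x hx h1))

theorem exists_split (h : Large (ρ + σ) Y) :
    ∃ Y₁ ⊆ Y, ∃ Y₂ ⊆ Y, Large ρ Y₁ ∧ Large σ Y₂ ∧ ∀ y ∈ Y₁, ∀ z ∈ Y₂, y < z := by
  obtain ⟨e, he, hm⟩ := h
  have hle : Iio ρ ⊆ Iio (ρ + σ) := Iio_subset_Iio le_self_add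
  refine ⟨e '' Iio ρ, ?_, e '' Set.Ico ρ (ρ + σ), ?_, image (he.mono hle),
    image_of_large (he.mono fun x hx => hx.2) (Ico ρ σ), ?_⟩
  · rintro _ ⟨x, hx, rfl⟩; exact hm (hle hx)
  · rintro _ ⟨x, hx, rfl⟩; exact hm hx.2
  · rintro _ ⟨x, hx, rfl⟩ _ ⟨y, hy, rfl⟩
    exact he (hle hx) hy.2 (lt_of_lt_of_le hx hy.1)

end Large

theorem large_iff_lift_le_otype {ρ : Ordinal.{0}} {Y : Set Ordinal.{0}} :
    Large ρ Y ↔ Ordinal.lift.{1} ρ ≤ otype Y := by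
  have hρ : Ordinal.lift.{1} ρ = Ordinal.type ((· < ·) : Iio ρ → Iio ρ → Prop) := by
    simp
  rw [hρ, otype, Ordinal.type_le_iff']
  constructor
  · rintro ⟨h, hh, hm⟩
    exact ⟨RelEmbedding.ofMonotone (fun x => ⟨h x, hm x.2⟩) fun a b hab => hh a.2 b.2 hab⟩
  · rintro ⟨g⟩
    refine ⟨fun x => if hx : x < ρ then (g ⟨x, hx⟩ : Ordinal) else 0, fun x hx y hy hxy => ?_,
      fun x hx => ?_⟩
    · have hx' : x < ρ := hx
      have hy' : y < ρ := hy
      simp only [hx', hy', dite_true]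
      exact g.map_rel_iff.2 (show (⟨x, hx⟩ : Iio ρ) < ⟨y, hy⟩ from hxy)
    · have hx' : x < ρ := hx
      simp only [hx', dite_true]
      exact (g ⟨x, hx⟩).2

theorem otype_image_Iio {ρ : Ordinal.{0}} {e : Ordinal.{0} → Ordinal.{0}}
    (he : StrictMonoOn e (Iio ρ)) : otype (e '' Iio ρ) = Ordinal.lift.{1} ρ := by
  have hρ : Ordinal.lift.{1} ρ = Ordinal.type ((· < ·) : Iio ρ → Iio ρ → Prop) := by
    simp
  rw [hρ, otype]
  exact ((he.orderIso e (Iio ρ)).toRelIsoLT.ordinalType_congr).symm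

theorem otype_coe_finset_s12 (B : Finset Ordinal.{0}) : otype (B : Set Ordinal) = (B.card : ℕ) := by
  rw [otype, Ordinal.type_fintype]
  simp

theorem Large.of_forall_lt {ρ : Ordinal.{0}} {Y : Set Ordinal.{0}} (hρ : Order.IsSuccLimit ρ)
    (h : ∀ μ < ρ, Large μ Y) : Large ρ Y := by
  rw [large_iff_lift_le_otype]
  by_contra! hlt
  obtain ⟨μ, hμ⟩ := Ordinal.mem_range_lift_of_le hlt.le
  rw [← hμ, Ordinal.lift_lt] at hlt
  have := large_iff_lift_le_otype.1 (h _ (hρ.succ_lt hlt))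
  rw [← hμ, Ordinal.lift_le] at this
  exact absurd this (not_le.2 (Order.lt_succ μ))

theorem Large.mul_natCast_inter_or_diff {σ : Ordinal.{0}} {P : Set Ordinal.{0}}
    (hσ : ∀ Y, Large σ Y → Large σ (Y ∩ P) ∨ Large σ (Y \ P)) (N : ℕ) :
    ∀ Y, Large (σ * N) Y → ∃ i j : ℕ, i + j = N ∧ Large (σ * i) (Y ∩ P) ∧ Large (σ * j) (Y \ P) := by
  induction N with
  | zero => exact fun Y _ => ⟨0, 0, rfl, by simpa using Large.zero _, by simpa using Large.zero _⟩
  | succ N ih =>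
    intro Y hY
    rw [Nat.cast_succ, mul_add, mul_one] at hY
    obtain ⟨Y₁, h₁, Y₂, h₂, hL₁, hL₂, hlt⟩ := hY.exists_split
    obtain ⟨i, j, rfl, hi, hj⟩ := ih Y₁ hL₁
    rcases hσ Y₂ hL₂ with h | h
    · refine ⟨i + 1, j, by omega, ?_, hj.mono le_rfl (sdiff_subset_sdiff_left h₁)⟩
      rw [Nat.cast_succ, mul_add, mul_one]
      exact (hi.add_of_forall_lt h fun y hy z hz => hlt y hy.1 z hz.1).mono le_rfl
        (union_subset (inter_subset_inter_left _ h₁) (inter_subset_inter_left _ h₂))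
    · refine ⟨i, j + 1, by omega, hi.mono le_rfl (inter_subset_inter_left _ h₁), ?_⟩
      rw [Nat.cast_succ, mul_add, mul_one]
      exact (hj.add_of_forall_lt h fun y hy z hz => hlt y hy.1 z hz.1).mono le_rfl
        (union_subset (sdiff_subset_sdiff_left h₁) (sdiff_subset_sdiff_left h₂))

theorem Large.omega0_opow_inter_or_diff (P : Set Ordinal.{0}) (δ : Ordinal.{0}) :
    ∀ Y, Large (ω ^ δ) Y → Large (ω ^ δ) (Y ∩ P) ∨ Large (ω ^ δ) (Y \ P) := by
  induction δ using Ordinal.limitRecOn with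
  | zero =>
    intro Y hY
    rw [opow_zero] at *
    obtain ⟨y, hy⟩ := hY.nonempty one_ne_zero
    by_cases h : y ∈ P
    · exact Or.inl (Large.one_of_mem ⟨hy, h⟩)
    · exact Or.inr (Large.one_of_mem ⟨hy, h⟩)
  | add_one δ ih =>
    intro Y hY
    by_contra! hcon
    have hlim : Order.IsSuccLimit (ω ^ Order.succ δ) :=
      isSuccLimit_opow_left isSuccLimit_omega0 (by simp)
    have key : ∀ Z, ¬ Large (ω ^ Order.succ δ) Z → ∃ n : ℕ, ¬ Large (ω ^ δ * n) Z := by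
      intro Z hZ
      by_contra! hn
      refine hZ (Large.of_forall_lt hlim fun μ hμ => ?_)
      rw [opow_succ] at hμ
      obtain ⟨n, hn', hμn⟩ := (lt_mul_iff_of_isSuccLimit isSuccLimit_omega0).1 hμ
      obtain ⟨n, rfl⟩ := lt_omega0.1 hn'
      exact (hn n).mono hμn.le subset_rfl
    obtain ⟨n₁, h₁⟩ := key _ hcon.1
    obtain ⟨n₂, h₂⟩ := key _ hcon.2
    have hle : ω ^ δ * ((n₁ + n₂ : ℕ) : Ordinal) ≤ ω ^ Order.succ δ := by
      rw [opow_succ]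
      gcongr
      exact (natCast_lt_omega0 _).le
    obtain ⟨i, j, hij, hi, hj⟩ :=
      Large.mul_natCast_inter_or_diff ih (n₁ + n₂) Y (hY.mono hle subset_rfl)
    rcases le_or_gt n₁ i with h | h
    · exact h₁ (hi.mono (by gcongr) subset_rfl)
    · exact h₂ (hj.mono (by gcongr; omega) subset_rfl)
  | limit δ hδ ih =>
    intro Y hY
    by_contra! hcon
    have hlim : Order.IsSuccLimit (ω ^ δ) := isSuccLimit_opow one_lt_omega0 hδ
    have key : ∀ Z, ¬ Large (ω ^ δ) Z → ∃ d < δ, ¬ Large (ω ^ d) Z := by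
      intro Z hZ
      by_contra! hn
      refine hZ (Large.of_forall_lt hlim fun μ hμ => ?_)
      obtain ⟨d, hd, hμd⟩ := (lt_opow_of_isSuccLimit omega0_ne_zero hδ).1 hμ
      exact (hn d hd).mono hμd.le subset_rfl
    obtain ⟨d₁, hd₁, h₁⟩ := key _ hcon.1
    obtain ⟨d₂, hd₂, h₂⟩ := key _ hcon.2
    have hd : max d₁ d₂ < δ := max_lt hd₁ hd₂
    have hle : ∀ d ≤ max d₁ d₂, ω ^ d ≤ ω ^ max d₁ d₂ := fun d h =>
      opow_le_opow_right omega0_pos h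
    rcases ih _ hd Y (hY.mono (opow_le_opow_right omega0_pos hd.le) subset_rfl) with h | h
    · exact h₁ (h.mono (hle _ (le_max_left _ _)) subset_rfl)
    · exact h₂ (h.mono (hle _ (le_max_right _ _)) subset_rfl)

theorem Large.omega0_opow_union {δ : Ordinal.{0}} {Y Z : Set Ordinal.{0}}
    (h : Large (ω ^ δ) (Y ∪ Z)) : Large (ω ^ δ) Y ∨ Large (ω ^ δ) Z := by
  rcases Large.omega0_opow_inter_or_diff Y δ _ h with h | h
  · exact Or.inl (h.mono le_rfl inter_subset_right)
  · exact Or.inr (h.mono le_rfl fun x hx => hx.1.resolve_left hx.2)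

theorem Large.omega0_opow_biUnion {δ : Ordinal.{0}} {Y : Ordinal.{0} → Set Ordinal.{0}}
    {s : Finset Ordinal.{0}} (h : Large (ω ^ δ) (⋃ i ∈ s, Y i)) : ∃ i ∈ s, Large (ω ^ δ) (Y i) := by
  classical
  induction s using Finset.induction_on with
  | empty =>
    simpa using h.nonempty (opow_ne_zero _ omega0_ne_zero)
  | insert a s ha ih =>
    rw [Finset.set_biUnion_insert] at h
    rcases h.omega0_opow_union with h | h
    · exact ⟨a, Finset.mem_insert_self _ _, h⟩
    · obtain ⟨i, hi, hL⟩ := ih h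
      exact ⟨i, Finset.mem_insert_of_mem hi, hL⟩

section Graph

variable {G : SimpleGraph Ordinal.{0}} {a : Ordinal.{0}} {k : ℕ} {S : Set Ordinal.{0}}

theorem not_large_setOf_not_large_inter_neighborSet (ha : a ≠ 0)
    (hk : ∀ Y ⊆ S, Large (ω ^ a) Y → ∃ B : Finset Ordinal.{0}, ↑B ⊆ Y ∧ G.IsNIndepSet k B)
    (h2k : ∀ B : Finset Ordinal.{0}, ↑B ⊆ S → ¬ G.IsNIndepSet (2 * k) B) (τ : Ordinal.{0}) :
    ∀ Y ⊆ S, Large (ω ^ a * τ) Y →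
      ¬ Large (ω ^ a) {x | x ∈ S ∧ ¬ Large (ω ^ a * τ) (Y ∩ G.neighborSet x)} := by
  classical
  induction τ using WellFoundedLT.induction with
  | ind τ ih =>
  intro Y hYS hY hbad
  by_cases hτ : IsPrincipal (· + ·) τ
  · rcases isPrincipal_add_iff_zero_or_omega0_opow.1 hτ with rfl | ⟨d, rfl⟩
    · obtain ⟨x, -, hx⟩ := hbad.nonempty (opow_ne_zero _ omega0_ne_zero)
      exact hx (by simpa using Large.zero _)
    · dsimp only at hY hbad
      rw [← opow_add] at hY hbad
      obtain ⟨B, hB, hBk⟩ := hk _ (fun x hx => hx.1) hbad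
      have hcov : Y ⊆ (⋃ x ∈ B, (Y ∩ G.neighborSet x) ∪ {x}) ∪
          {y | y ∈ Y ∧ ∀ x ∈ B, ¬ G.Adj x y ∧ y ≠ x} := by
        intro y hy
        by_cases h : ∀ x ∈ B, ¬ G.Adj x y ∧ y ≠ x
        · exact Or.inr ⟨hy, h⟩
        · left
          push Not at h
          obtain ⟨x, hx, h⟩ := h
          refine mem_biUnion hx ?_
          by_cases hadj : G.Adj x y
          · exact Or.inl ⟨hy, hadj⟩
          · exact Or.inr (h hadj)
      rcases (hY.mono le_rfl hcov).omega0_opow_union with h | h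
      · obtain ⟨x, hx, h⟩ := h.omega0_opow_biUnion
        rcases h.omega0_opow_union with h | h
        · exact (hB hx).2 h
        · obtain ⟨e, he, hm⟩ := h
          have h1 : (1 : Ordinal) < ω ^ (a + d) := by
            rw [← opow_zero ω, opow_lt_opow_iff_right one_lt_omega0]
            exact (pos_iff_ne_zero.2 ha).trans_le le_self_add
          have h0 : (0 : Ordinal) < ω ^ (a + d) := zero_lt_one.trans h1
          exact ((he h0 h1 zero_lt_one).ne) ((hm h0).trans (hm h1).symm)
      · obtain ⟨B', hB', hBk'⟩ := hk _ (fun y hy => hYS hy.1)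
          (h.mono (opow_le_opow_right omega0_pos le_self_add) subset_rfl)
        have hdisj : Disjoint B B' := Finset.disjoint_left.2 fun x hx hx' =>
          ((hB' hx').2 x hx).2 rfl
        refine h2k (B ∪ B') ?_ ⟨?_, ?_⟩
        · rw [Finset.coe_union]
          exact union_subset (fun x hx => (hB hx).1) fun y hy => hYS (hB' hy).1
        · rw [Finset.coe_union]
          refine Set.pairwise_union.2 ⟨hBk.1, hBk'.1, fun x hx y hy _ => ?_⟩
          have hxy := ((hB' hy).2 x hx).1
          exact ⟨hxy, fun h => hxy h.symm⟩
        · rw [Finset.card_union_of_disjoint hdisj, hBk.2, hBk'.2, two_mul]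
  · obtain ⟨b, hb, c, hc, rfl⟩ := exists_lt_add_of_not_isPrincipal_add hτ
    rw [mul_add] at hY hbad
    obtain ⟨Y₁, h₁, Y₂, h₂, hL₁, hL₂, hlt⟩ := hY.exists_split
    have hcov : {x | x ∈ S ∧ ¬ Large (ω ^ a * b + ω ^ a * c) (Y ∩ G.neighborSet x)} ⊆
        {x | x ∈ S ∧ ¬ Large (ω ^ a * b) (Y₁ ∩ G.neighborSet x)} ∪
        {x | x ∈ S ∧ ¬ Large (ω ^ a * c) (Y₂ ∩ G.neighborSet x)} := by
      rintro x ⟨hxS, hx⟩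
      by_contra! hcon
      simp only [mem_union, mem_ofPred_eq, hxS, true_and, not_or, not_not] at hcon
      exact hx ((hcon.1.add_of_forall_lt hcon.2 fun y hy z hz => hlt y hy.1 z hz.1).mono le_rfl
        (union_subset (inter_subset_inter_left _ h₁) (inter_subset_inter_left _ h₂)))
    rcases (hbad.mono le_rfl hcov).omega0_opow_union with h | h
    · exact ih b hb Y₁ (h₁.trans hYS) hL₁ h
    · exact ih c hc Y₂ (h₂.trans hYS) hL₂ h

/-- `e'` enumerates, in increasing order of type `α * β`, part of the values of `e` without moving
any of them across the positions `α * t` with `t ∈ T`. -/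
structure Refines (α β : Ordinal.{0}) (T : Finset Ordinal.{0})
    (e e' : Ordinal.{0} → Ordinal.{0}) : Prop where
  strictMonoOn : StrictMonoOn e' (Iio (α * β))
  exists_eq : ∀ y < α * β, ∃ z < α * β, e' y = e z ∧ ∀ t ∈ T, (y < α * t ↔ z < α * t)

theorem not_large_setOf_not_exists_refines (ha : a ≠ 0)
    (hk : ∀ Y ⊆ S, Large (ω ^ a) Y → ∃ B : Finset Ordinal.{0}, ↑B ⊆ Y ∧ G.IsNIndepSet k B)
    (h2k : ∀ B : Finset Ordinal.{0}, ↑B ⊆ S → ¬ G.IsNIndepSet (2 * k) B)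
    (T : Finset Ordinal.{0}) :
    ∀ β e, StrictMonoOn e (Iio (ω ^ a * β)) → MapsTo e (Iio (ω ^ a * β)) S →
      ¬ Large (ω ^ a) {x | x ∈ S ∧
        ¬ ∃ e', Refines (ω ^ a) β T e e' ∧ ∀ y < ω ^ a * β, G.Adj x (e' y)} := by
  induction T using Finset.induction_on_max with
  | empty =>
    intro β e he hm hbad
    refine not_large_setOf_not_large_inter_neighborSet ha hk h2k β (e '' Iio (ω ^ a * β))
      hm.image_subset (Large.image he) (hbad.mono le_rfl ?_)
    rintro x ⟨hxS, hx⟩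
    refine ⟨hxS, fun ⟨h, hh, hhm⟩ => hx ⟨h, ⟨hh, fun y hy => ?_⟩, fun y hy => (hhm hy).2⟩⟩
    obtain ⟨z, hz, hzy⟩ := (hhm hy).1
    exact ⟨z, hz, hzy.symm, by simp⟩
  | insert t T hT ih =>
    intro β e he hm hbad
    rcases le_or_gt β t with hβ | hβ
    · refine ih β e he hm (hbad.mono le_rfl ?_)
      rintro x ⟨hxS, hx⟩
      refine ⟨hxS, fun ⟨e', hr, hadj⟩ => hx ⟨e', ⟨hr.strictMonoOn, fun y hy => ?_⟩, hadj⟩⟩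
      obtain ⟨z, hz, hzy, hzT⟩ := hr.exists_eq y hy
      refine ⟨z, hz, hzy, fun s hs => ?_⟩
      rcases Finset.mem_insert.1 hs with rfl | hs
      · have hle : ω ^ a * β ≤ ω ^ a * s := by gcongr
        exact ⟨fun _ => hz.trans_le hle, fun _ => hy.trans_le hle⟩
      · exact hzT s hs
    · obtain ⟨τ, rfl⟩ : ∃ τ, β = t + τ := ⟨β - t, (Ordinal.add_sub_cancel_of_le hβ.le).symm⟩
      have hmul : ω ^ a * (t + τ) = ω ^ a * t + ω ^ a * τ := mul_add _ _ _
      have hle : ω ^ a * t ≤ ω ^ a * (t + τ) := by rw [hmul]; exact le_self_add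
      let Y := e '' Ico (ω ^ a * t) (ω ^ a * t + ω ^ a * τ)
      have hYsub : Ico (ω ^ a * t) (ω ^ a * t + ω ^ a * τ) ⊆ Iio (ω ^ a * (t + τ)) := by
        rw [hmul]; exact fun x hx => hx.2
      have hYS : Y ⊆ S := (hm.mono_left hYsub).image_subset
      have hYL : Large (ω ^ a * τ) Y := Large.image_of_large (he.mono hYsub) (Large.Ico _ _)
      have hcov : {x | x ∈ S ∧ ¬ ∃ e', Refines (ω ^ a) (t + τ) (insert t T) e e' ∧
            ∀ y < ω ^ a * (t + τ), G.Adj x (e' y)} ⊆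
          {x | x ∈ S ∧ ¬ ∃ e', Refines (ω ^ a) t T e e' ∧ ∀ y < ω ^ a * t, G.Adj x (e' y)} ∪
          {x | x ∈ S ∧ ¬ Large (ω ^ a * τ) (Y ∩ G.neighborSet x)} := by
        rintro x ⟨hxS, hx⟩
        by_contra hcon
        simp only [mem_union, mem_ofPred_eq, hxS, true_and, not_or, not_not] at hcon
        obtain ⟨⟨e₁, hr, hadj⟩, h, hh, hhm⟩ := hcon
        have hsub : ∀ y, y < ω ^ a * (t + τ) → ¬ y < ω ^ a * t → y - ω ^ a * t < ω ^ a * τ := by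
          intro y hy hy'
          rw [← add_lt_add_iff_left (ω ^ a * t), Ordinal.add_sub_cancel_of_le (not_lt.1 hy'),
            ← hmul]
          exact hy
        refine hx ⟨fun y => if y < ω ^ a * t then e₁ y else h (y - ω ^ a * t),
          ⟨fun y hy z hz hyz => ?_, fun y hy => ?_⟩, fun y hy => ?_⟩
        · split_ifs with h1 h2 h2
          · exact hr.strictMonoOn h1 h2 hyz
          · obtain ⟨u, hu, hu', -⟩ := hr.exists_eq y h1
            obtain ⟨v, hv, hv'⟩ := (hhm (hsub z hz h2)).1
            rw [hu', ← hv']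
            exact he (hu.trans_le hle) (hYsub hv) (hu.trans_le hv.1)
          · exact absurd (hyz.trans h2) h1
          · refine hh (hsub y hy h1) (hsub z hz h2) ?_
            rw [← add_lt_add_iff_left (ω ^ a * t), Ordinal.add_sub_cancel_of_le (not_lt.1 h1),
              Ordinal.add_sub_cancel_of_le (not_lt.1 h2)]
            exact hyz
        · split_ifs with h1
          · obtain ⟨u, hu, hu', huT⟩ := hr.exists_eq y h1
            refine ⟨u, hu.trans_le hle, hu', fun s hs => ?_⟩
            rcases Finset.mem_insert.1 hs with rfl | hs
            · exact ⟨fun _ => hu, fun _ => h1⟩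
            · exact huT s hs
          · obtain ⟨v, hv, hv'⟩ := (hhm (hsub y hy h1)).1
            refine ⟨v, hYsub hv, hv'.symm, fun s hs => ?_⟩
            have hst : ω ^ a * s ≤ ω ^ a * t := by
              rcases Finset.mem_insert.1 hs with rfl | hs
              · exact le_rfl
              · have := (hT s hs).le
                gcongr
            exact ⟨fun h => absurd (h.trans_le hst) h1,
              fun h => absurd (h.trans_le hst) (not_lt.2 hv.1)⟩
        · dsimp only
          split_ifs with h1
          · exact hadj y h1
          · exact (hhm (hsub y hy h1)).2
      rcases (hbad.mono le_rfl hcov).omega0_opow_union with h | h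
      · exact ih t e (he.mono (Iio_subset_Iio hle)) (hm.mono_left (Iio_subset_Iio hle)) h
      · exact not_large_setOf_not_large_inter_neighborSet ha hk h2k τ Y hYS hYL h

theorem exists_mem_block_and_refines (ha : a ≠ 0)
    (hk : ∀ Y ⊆ S, Large (ω ^ a) Y → ∃ B : Finset Ordinal.{0}, ↑B ⊆ Y ∧ G.IsNIndepSet k B)
    (h2k : ∀ B : Finset Ordinal.{0}, ↑B ⊆ S → ¬ G.IsNIndepSet (2 * k) B)
    (T : Finset Ordinal.{0}) {b β : Ordinal.{0}} (hb : b < β) {e : Ordinal.{0} → Ordinal.{0}}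
    (he : StrictMonoOn e (Iio (ω ^ a * β))) (hm : MapsTo e (Iio (ω ^ a * β)) S) :
    ∃ y ∈ Ico (ω ^ a * b) (ω ^ a * (b + 1)),
      ∃ e', Refines (ω ^ a) β T e e' ∧ ∀ z < ω ^ a * β, G.Adj (e y) (e' z) := by
  by_contra! hcon
  have hle : ω ^ a * (b + 1) ≤ ω ^ a * β := by
    have : b + 1 ≤ β := Order.add_one_le_of_lt hb
    gcongr
  have hsub : Ico (ω ^ a * b) (ω ^ a * (b + 1)) ⊆ Iio (ω ^ a * β) := fun x hx => hx.2.trans_le hle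
  have hL : Large (ω ^ a) (e '' Ico (ω ^ a * b) (ω ^ a * (b + 1))) := by
    refine Large.image_of_large (he.mono hsub) ?_
    rw [mul_add, mul_one]
    exact Large.Ico _ _
  refine not_large_setOf_not_exists_refines ha hk h2k T β e he hm (hL.mono le_rfl ?_)
  rintro _ ⟨y, hy, rfl⟩
  refine ⟨hm (hsub hy), fun ⟨e', hr, hadj⟩ => ?_⟩
  obtain ⟨z, hz, hz'⟩ := hcon y hy e' hr
  exact hz' (hadj z hz)

theorem exists_adj_sequence (ha : a ≠ 0) {β : Ordinal.{0}}
    (hk : ∀ Y ⊆ Iio (ω ^ a * β), Large (ω ^ a) Y →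
      ∃ B : Finset Ordinal.{0}, ↑B ⊆ Y ∧ G.IsNIndepSet k B)
    (h2k : ∀ B : Finset Ordinal.{0}, ↑B ⊆ Iio (ω ^ a * β) → ¬ G.IsNIndepSet (2 * k) B)
    {b : ℕ → Ordinal.{0}} (hb : ∀ n, b n < β) :
    ∃ x : ℕ → Ordinal.{0}, (∀ n, x n < ω ^ a * β) ∧ (∀ n m, n < m → G.Adj (x n) (x m)) ∧
      ∀ n m, b n < b m → x n < x m := by
  set α := ω ^ a
  let T : ℕ → Finset Ordinal.{0} := fun n =>
    (Finset.range (n + 1)).image b ∪ (Finset.range (n + 1)).image fun i => b i + 1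
  have hT : ∀ n m, n ≤ m → T n ⊆ T m := fun n m h =>
    Finset.union_subset_union (Finset.image_subset_image (Finset.range_subset_range.2 (by omega)))
      (Finset.image_subset_image (Finset.range_subset_range.2 (by omega)))
  have hT₀ : ∀ n, b n ∈ T n := fun n =>
    Finset.mem_union_left _ (Finset.mem_image_of_mem _ (Finset.self_mem_range_succ n))
  have hT₁ : ∀ n, b n + 1 ∈ T n := fun n =>
    Finset.mem_union_right _
      (Finset.mem_image_of_mem (fun i => b i + 1) (Finset.self_mem_range_succ n))
  let E := {e : Ordinal.{0} → Ordinal.{0} //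
    StrictMonoOn e (Iio (α * β)) ∧ MapsTo e (Iio (α * β)) (Iio (α * β))}
  have step : ∀ (n : ℕ) (e : E), ∃ y ∈ Ico (α * b n) (α * (b n + 1)),
      ∃ e' : E, Refines α β (T n) e.1 e'.1 ∧ ∀ z < α * β, G.Adj (e.1 y) (e'.1 z) := by
    intro n e
    obtain ⟨y, hy, e', hr, hadj⟩ := exists_mem_block_and_refines ha hk h2k (T n) (hb n) e.2.1 e.2.2
    refine ⟨y, hy, ⟨e', hr.strictMonoOn, fun z hz => ?_⟩, hr, hadj⟩
    obtain ⟨w, hw, hw', -⟩ := hr.exists_eq z hz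
    rw [hw']
    exact e.2.2 hw
  choose Y hY next hr hadj using step
  let e : ℕ → E := fun n => Nat.rec ⟨id, strictMono_id.strictMonoOn _, fun _ h => h⟩ next n
  let y : ℕ → Ordinal.{0} := fun n => Y n (e n)
  have hyb : ∀ n, α * b n ≤ y n ∧ y n < α * (b n + 1) := fun n => hY n (e n)
  have hy : ∀ n, y n < α * β := fun n => by
    have : b n + 1 ≤ β := Order.add_one_le_of_lt (hb n)
    exact (hyb n).2.trans_le (by gcongr)
  have hchain : ∀ n m, n ≤ m → ∀ u < α * β, ∃ z < α * β,
      (e m).1 u = (e n).1 z ∧ ∀ t ∈ T n, (u < α * t ↔ z < α * t) := by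
    intro n m hnm
    induction m, hnm using Nat.le_induction with
    | base => exact fun u hu => ⟨u, hu, rfl, fun _ _ => Iff.rfl⟩
    | succ m hnm ih =>
      intro u hu
      obtain ⟨v, hv, huv, hvT⟩ := (hr m (e m)).exists_eq u hu
      obtain ⟨z, hz, hvz, hzT⟩ := ih v hv
      exact ⟨z, hz, huv.trans hvz, fun t ht => (hvT t (hT n m hnm ht)).trans (hzT t ht)⟩
  refine ⟨fun n => (e n).1 (y n), fun n => (e n).2.2 (hy n), fun n m hnm => ?_,
    fun n m hnm => ?_⟩
  · obtain ⟨z, hz, h, -⟩ := hchain (n + 1) m hnm (y m) (hy m)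
    dsimp only
    rw [h]
    exact hadj n (e n) z hz
  · dsimp only
    have hle : α * (b n + 1) ≤ α * b m := by
      have : b n + 1 ≤ b m := Order.add_one_le_of_lt hnm
      gcongr
    rcases le_total n m with h | h
    · obtain ⟨z, hz, h, hzT⟩ := hchain n m h (y m) (hy m)
      rw [h]
      refine (e n).2.1 (hy n) hz ((hyb n).2.trans_le (not_lt.1 fun hlt => ?_))
      exact absurd ((hzT _ (hT₁ n)).2 hlt) (not_lt.2 (hle.trans (hyb m).1))
    · obtain ⟨z, hz, h, hzT⟩ := hchain m n h (y n) (hy n)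
      rw [h]
      exact (e m).2.1 hz (hy m)
        (((hzT _ (hT₀ m)).1 ((hyb n).2.trans_le hle)).trans_le (hyb m).1)

end Graph

/-- The partition relation `α → (k, γ)²` for graphs on the ordinals, with finite first target. -/
def Arrow (α : Ordinal.{0}) (k : ℕ) (γ : Ordinal.{0}) : Prop :=
  ∀ G : SimpleGraph Ordinal.{0}, (∃ B : Finset Ordinal.{0}, ↑B ⊆ Iio α ∧ G.IsNIndepSet k B) ∨
    ∃ φ : Ordinal.{0} → Ordinal.{0}, StrictMonoOn φ (Iio γ) ∧ MapsTo φ (Iio γ) (Iio α) ∧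
      G.IsClique (φ '' Iio γ)

theorem exists_strictMonoOn_of_sequence {β : Ordinal.{0}} {b x : ℕ → Ordinal.{0}}
    (hx : Function.Injective x) (hb : ∀ c < β, {n | b n = c}.Infinite)
    (hlt : ∀ n m, b n < b m → x n < x m) :
    ∃ φ : Ordinal.{0} → Ordinal.{0}, StrictMonoOn φ (Iio (ω * β)) ∧
      ∀ p < ω * β, φ p ∈ range x := by
  have hg : ∀ c < β, ∃ g : ℕ → ℕ, StrictMono (x ∘ g) ∧ ∀ j, b (g j) = c := by
    intro c hc
    let s := Nat.nth fun n => b n = c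
    have hs : StrictMono s := Nat.nth_strictMono (hb c hc)
    obtain ⟨g, h | h⟩ := exists_increasing_or_nonincreasing_subseq (· < ·) (x ∘ s)
    · exact ⟨s ∘ g, fun i j hij => h i j hij, fun j => Nat.nth_mem_of_infinite (hb c hc) _⟩
    · exfalso
      have hanti : StrictAnti (x ∘ s ∘ g) := fun i j hij =>
        lt_of_le_of_ne (not_lt.1 (h i j hij)) fun heq =>
          hij.ne' (g.injective (hs.injective (hx heq)))
      exact (RelEmbedding.natGT _ fun n => hanti n.lt_succ_self).not_wellFounded wellFounded_lt
  choose! g hg hgb using hg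
  have hJ : ∀ p : Ordinal.{0}, ∃ j : ℕ, p % ω = j := fun p =>
    lt_omega0.1 (mod_lt p omega0_ne_zero)
  choose J hJ using hJ
  have hdiv : ∀ p, p < ω * β → p / ω < β := fun p hp =>
    (lt_mul_iff_div_lt omega0_ne_zero).1 hp
  refine ⟨fun p => x (g (p / ω) (J p)), fun p hp q hq hpq => ?_, fun p _ => mem_range_self _⟩
  have hle : p / ω ≤ q / ω := Ordinal.div_le_left hpq.le _
  rcases hle.lt_or_eq with h | h
  · exact hlt _ _ (by rwa [hgb _ (hdiv p hp), hgb _ (hdiv q hq)])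
  · dsimp only
    rw [← h]
    refine hg _ (hdiv p hp) ?_
    have h1 := div_add_mod p ω
    have h2 := div_add_mod q ω
    rw [← h1, ← h2, ← h, add_lt_add_iff_left, hJ, hJ] at hpq
    exact_mod_cast hpq

theorem Arrow.exists_isNIndepSet {α γ : Ordinal.{0}} {k : ℕ} (h : Arrow α k γ)
    {G : SimpleGraph Ordinal.{0}} {Y : Set Ordinal.{0}} (hY : Large α Y) :
    (∃ B : Finset Ordinal.{0}, ↑B ⊆ Y ∧ G.IsNIndepSet k B) ∨
    ∃ φ : Ordinal.{0} → Ordinal.{0}, StrictMonoOn φ (Iio γ) ∧ MapsTo φ (Iio γ) Y ∧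
      G.IsClique (φ '' Iio γ) := by
  classical
  obtain ⟨e, he, hm⟩ := hY
  rcases h (G.comap e) with ⟨B, hB, hBk⟩ | ⟨φ, hφ, hφm, hφc⟩
  · left
    refine ⟨B.image e, ?_, ?_, ?_⟩
    · rw [Finset.coe_image]
      exact (hm.mono_left hB).image_subset
    · rw [Finset.coe_image]
      rintro _ ⟨u, hu, rfl⟩ _ ⟨v, hv, rfl⟩ huv
      exact hBk.1 hu hv fun h => huv (h ▸ rfl)
    · rw [Finset.card_image_of_injOn (he.injOn.mono hB), hBk.2]
  · right
    refine ⟨e ∘ φ, fun p hp q hq hpq => he (hφm hp) (hφm hq) (hφ hp hq hpq),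
      hm.comp hφm, ?_⟩
    rintro _ ⟨p, hp, rfl⟩ _ ⟨q, hq, rfl⟩ hne
    exact hφc ⟨p, hp, rfl⟩ ⟨q, hq, rfl⟩ fun h => hne (congrArg e h)

theorem Arrow.omega0_opow_mul {a β : Ordinal.{0}} {k : ℕ} (ha : a ≠ 0) (hβ : (Iio β).Countable)
    (h : Arrow (ω ^ a) k (ω * β)) : Arrow (ω ^ a * β) (2 * k) (ω * β) := by
  intro G
  by_contra! hcon
  obtain ⟨h2k, hγ⟩ := hcon
  have hk : ∀ Y ⊆ Iio (ω ^ a * β), Large (ω ^ a) Y →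
      ∃ B : Finset Ordinal.{0}, ↑B ⊆ Y ∧ G.IsNIndepSet k B := by
    intro Y hY hL
    rcases h.exists_isNIndepSet hL with h | ⟨φ, hφ, hm, hc⟩
    · exact h
    · exact absurd hc (hγ φ hφ (hm.mono_right hY))
  rcases eq_or_ne β 0 with rfl | hβ0
  · refine hγ id (strictMono_id.strictMonoOn _) ?_ ?_ <;> simp
  have : Nonempty (Iio β) := ⟨⟨0, pos_iff_ne_zero.2 hβ0⟩⟩
  have : Countable (Iio β) := hβ.to_subtype
  obtain ⟨f, hf⟩ := exists_surjective_nat (Iio β × ℕ)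
  obtain ⟨x, hxα, hxadj, hxlt⟩ := exists_adj_sequence (b := fun n => (f n).1) ha hk h2k
    fun n => (f n).1.2
  have hadj : ∀ n m, n ≠ m → G.Adj (x n) (x m) := fun n m hnm =>
    hnm.lt_or_gt.elim (hxadj n m) fun h => (hxadj m n h).symm
  have hinj : Function.Injective x := fun n m hnm => by
    by_contra hne
    exact (hadj n m hne).ne hnm
  have hinf : ∀ c < β, {n | ((f n).1 : Ordinal) = c}.Infinite := fun c hc =>
    Set.infinite_of_injective_forall_mem (f := fun j : ℕ => Function.surjInv hf (⟨c, hc⟩, j))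
      (fun i j hij => by simpa using Function.injective_surjInv hf hij)
      fun j => by simp [Function.surjInv_eq hf]
  obtain ⟨φ, hφ, hφx⟩ := exists_strictMonoOn_of_sequence hinj hinf hxlt
  refine hγ φ hφ (fun p hp => ?_) ?_
  · obtain ⟨n, hn⟩ := hφx p hp
    exact hn ▸ hxα n
  · rintro _ ⟨p, hp, rfl⟩ _ ⟨q, hq, rfl⟩ hne
    obtain ⟨n, hn⟩ := hφx p hp
    obtain ⟨m, hm⟩ := hφx q hq
    rw [← hn, ← hm] at hne ⊢
    exact hadj n m fun h => hne (congrArg x h)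

theorem countable_Iio_omega0_opow {ν : Ordinal.{0}} (hν : ν < (Cardinal.aleph 1).ord) :
    (Iio (ω ^ ν)).Countable := by
  have h : ω ^ ν < (Cardinal.aleph 1).ord := by
    refine isPrincipal_opow_ord (Cardinal.aleph0_le_aleph 1) ?_ hν
    rw [Cardinal.lt_ord, card_omega0]
    exact Cardinal.aleph0_lt_aleph_one
  rw [Cardinal.lt_ord] at h
  rw [← Cardinal.le_aleph0_iff_set_countable, Cardinal.mk_Iio_ordinal,
    Cardinal.lift_le_aleph0]
  exact Cardinal.lt_aleph_one_iff.1 h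

theorem arrow_omega0_opow {ν : Ordinal.{0}} (hν : ν < (Cardinal.aleph 1).ord) (n : ℕ) :
    Arrow (ω ^ (1 + ν * n)) (2 ^ n) (ω ^ (1 + ν)) := by
  induction n with
  | zero =>
    intro G
    refine Or.inl ⟨{0}, by simp [omega0_pos], ?_, by simp⟩
    simp [SimpleGraph.IsIndepSet]
  | succ n ih =>
    rw [Nat.cast_succ, mul_add, mul_one, ← add_assoc, opow_add ω (1 + ν * n), pow_succ']
    rw [opow_add ω 1 ν, opow_one] at ih ⊢
    exact ih.omega0_opow_mul (by simp) (countable_Iio_omega0_opow hν)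

theorem Arrow.partRel {α γ : Ordinal.{0}} {k : ℕ} (h : Arrow α k γ) : PartRel α k γ := by
  intro f
  let G : SimpleGraph Ordinal.{0} :=
    { Adj := fun x y => x ≠ y ∧ f {x, y} = 1
      symm := ⟨fun x y h => ⟨h.1.symm, by rw [Finset.pair_comm]; exact h.2⟩⟩
      loopless := ⟨fun x h => h.1 rfl⟩ }
  rcases h G with ⟨B, hB, hBk⟩ | ⟨φ, hφ, hm, hc⟩
  · refine Or.inl ⟨B, hB, ?_, fun x hx y hy hxy => ?_⟩
    · rw [otype_coe_finset_s12, hBk.2, lift_natCast]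
    · by_contra hne
      exact hBk.1 hx hy hxy ⟨hxy, by omega⟩
  · exact Or.inr ⟨_, hm.image_subset, otype_image_Iio hφ, fun x hx y hy hxy => (hc hx hy hxy).2⟩

theorem stmt12 (ν : Ordinal) (hν : ν < (Cardinal.aleph 1).ord) (n : ℕ) :
    PartRel (Ordinal.omega0 ^ (1 + ν * n)) ((2 : Ordinal) ^ n)
      (Ordinal.omega0 ^ (1 + ν)) := by
  simpa using (arrow_omega0_opow hν n).partRel
end
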